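/- Let q = p^s with p prime and let 0 ≤ i ≤ s−1 with h = gcd(i,s), and suppose p = 2 and the 2-adic valuation of i is at least that of s (so that gcd(2^i+1, 2^s−1) = 1). Then x ↦ x^{2^i+1} is a permutation of F_q, and for each c ∈ F_q with c ≠ 0, in the multiset {x^{2^i+1} − c·x : x ∈ F_q}: exactly (2^{s+h}+2^h)/(2(2^h+1)) elements of F_q do not occur, exactly 2^{s−h}−1 elements occur once, exactly (2^{s+h}−2^{s+1}+2^h)/(2(2^h−1)) elements occur twice, and exactly (2^{s−h}−1)/(2^{2h}−1) elements occur 2^h+1 times. -/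

import Mathlib

section Core
open Finset Classical

variable {F : Type*} [Field F] [Fintype F]

/-- number of `w` with `(σ y + c) σ w + y w + 1 = 0`. -/
noncomputable def NN (σ : F ≃+* F) (c y : F) : ℕ :=
  #{w : F | (σ y + c) * σ w + y * w + 1 = 0}

/-- size of the fibre over `b`. -/
noncomputable def nn (σ : F ≃+* F) (c b : F) : ℕ :=
  #{x : F | σ x * x - c * x = b}

lemma nn_eq (h2 : (2 : F) = 0) (σ : F ≃+* F) (c y : F) :
    nn σ c (σ y * y - c * y) = NN σ c y + 1 := by
  unfold nn NN
  have hy : y ∈ ({x : F | σ x * x - c * x = σ y * y - c * y} : Finset F) := by simp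
  rw [← card_erase_add_one hy]
  congr 1
  refine card_nbij' (fun x => (x - y)⁻¹) (fun w => y + w⁻¹) ?_ ?_ ?_ ?_
  · intro x hx
    simp only [coe_erase, coe_filter, mem_univ, true_and, Set.mem_sdiff, Set.mem_ofPred_eq,
      Set.mem_singleton_iff] at hx ⊢
    obtain ⟨hx, hne⟩ := hx
    have hd : x - y ≠ 0 := sub_ne_zero.2 hne
    obtain ⟨d, hd'⟩ : ∃ d, d = x - y := ⟨_, rfl⟩
    have hxd : x = y + d := by rw [hd']; ring
    rw [← hd'] at hd ⊢
    subst hxd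
    have hs : σ d ≠ 0 := by simpa using hd
    simp only [map_inv₀, map_add] at hx ⊢
    field_simp
    linear_combination hx + c * d * h2
  · intro w hw
    simp only [coe_erase, coe_filter, mem_univ, true_and, Set.mem_sdiff, Set.mem_ofPred_eq,
      Set.mem_singleton_iff] at hw ⊢
    have hw0 : w ≠ 0 := by rintro rfl; simp at hw
    have hs : σ w ≠ 0 := by simpa using hw0
    refine ⟨?_, by simpa using hw0⟩
    simp only [map_inv₀, map_add]
    field_simp
    linear_combination hw - c * σ w * h2
  · intro x hx; simp
  · intro x hx; simp

lemma ker_card (σ : F ≃+* F) (P : ℕ) (hP : #{r : F | σ r = r} = P) (a b v0 : F)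
    (hab : ¬ (a = 0 ∧ b = 0)) (hv : v0 ≠ 0) (h0 : a * σ v0 + b * v0 = 0) :
    #{v : F | a * σ v + b * v = 0} = P := by
  have hs : σ v0 ≠ 0 := by simpa using hv
  have ha : a ≠ 0 := by
    rintro rfl
    simp [hv] at h0
    exact hab ⟨rfl, h0⟩
  rw [← hP]
  refine card_nbij' (fun v => v / v0) (fun r => r * v0) ?_ ?_ ?_ ?_
  · intro v h
    simp only [coe_filter, mem_univ, true_and, Set.mem_ofPred_eq, map_div₀] at h ⊢
    field_simp
    apply mul_left_cancel₀ ha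
    linear_combination v0 * h - v * h0
  · intro r h
    simp only [coe_filter, mem_univ, true_and, Set.mem_ofPred_eq, map_mul] at h ⊢
    rw [h]
    linear_combination r * h0
  · intro v _; simp [hv]
  · intro v _; simp [hv]

lemma NN_eq_ker (σ : F ≃+* F) (c y : F) (hN : NN σ c y ≠ 0) :
    NN σ c y = #{v : F | (σ y + c) * σ v + y * v = 0} := by
  unfold NN at *
  obtain ⟨w, hw⟩ := card_pos.1 (Nat.pos_of_ne_zero hN)
  simp at hw
  refine card_nbij' (fun v => v - w) (fun r => r + w) ?_ ?_ ?_ ?_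
  · intro v h
    simp only [coe_filter, mem_univ, true_and, Set.mem_ofPred_eq, map_sub] at h ⊢
    linear_combination h - hw
  · intro v h
    simp only [coe_filter, mem_univ, true_and, Set.mem_ofPred_eq, map_add] at h ⊢
    linear_combination h + hw
  · intro v _; simp
  · intro v _; simp

lemma NN_cases (σ : F ≃+* F) (P : ℕ) (hP : #{r : F | σ r = r} = P) (c y : F) (hc : c ≠ 0) :
    NN σ c y = 0 ∨ NN σ c y = 1 ∨ NN σ c y = P := by
  by_cases hN : NN σ c y = 0
  · exact Or.inl hN
  right
  rw [NN_eq_ker σ c y hN]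
  by_cases h : ∃ v : F, v ≠ 0 ∧ (σ y + c) * σ v + y * v = 0
  · obtain ⟨v, hv, h⟩ := h
    right
    refine ker_card σ P hP _ _ v ?_ hv h
    rintro ⟨h1, rfl⟩
    simp at h1
    exact hc h1
  · left
    push Not at h
    rw [card_eq_one]
    refine ⟨0, ?_⟩
    ext v
    simp only [mem_filter, mem_univ, true_and, mem_singleton]
    constructor
    · intro hv; by_contra h0; exact h v h0 hv
    · rintro rfl; simp

lemma sum_NN (h2 : (2 : F) = 0) (σ : F ≃+* F) (hσ : ∀ z, σ z + z + 1 ≠ 0) (c : F) (hc : c ≠ 0) :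
    ∑ y : F, NN σ c y = Fintype.card F := by
  have h1 : ∑ y : F, NN σ c y = #{p : F × F | (σ p.1 + c) * σ p.2 + p.1 * p.2 + 1 = 0} := by
    simp only [NN, card_filter, Fintype.sum_prod_type]
  rw [h1, ← card_univ]
  have hw0 : ∀ z : F, σ.symm ((σ z + z + 1) / c) ≠ 0 := by
    intro z; rw [Ne, RingEquiv.map_eq_zero_iff]; exact div_ne_zero (hσ z) hc
  refine card_nbij' (fun p => p.1 * p.2)
    (fun z => (z / σ.symm ((σ z + z + 1) / c), σ.symm ((σ z + z + 1) / c))) ?_ ?_ ?_ ?_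
  · intro p _; simp
  · intro z _
    simp only [coe_filter, mem_univ, true_and, Set.mem_ofPred_eq, map_div₀, RingEquiv.apply_symm_apply]
    have := hw0 z
    rw [div_mul_cancel₀ _ (by simpa [hc] using this)]
    have := hσ z
    field_simp
    linear_combination (σ z + z + 1) * h2
  · rintro ⟨y, w⟩ h
    simp only [coe_filter, mem_univ, true_and, Set.mem_ofPred_eq] at h
    have hw : w ≠ 0 := by rintro rfl; simp at h
    have : σ.symm ((σ (y * w) + y * w + 1) / c) = w := by
      rw [RingEquiv.symm_apply_eq, div_eq_iff hc, map_mul]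
      linear_combination h - c * σ w * h2
    simp only [this]
    simp [hw]
  · intro z _
    exact div_mul_cancel₀ _ (hw0 z)

lemma sum_NN2 (h2 : (2 : F) = 0) (σ : F ≃+* F) (hσ : ∀ z, σ z + z + 1 ≠ 0) (c : F) (hc : c ≠ 0) :
    ∑ y : F, NN σ c y * (NN σ c y - 1) = #{r : F | σ r ≠ r} := by
  have h0 : ∀ y, NN σ c y * (NN σ c y - 1) =
      #{w : F | (σ y + c) * σ w + y * w + 1 = 0} *
      #{v : F | v ≠ 0 ∧ (σ y + c) * σ v + y * v = 0} := by
    intro y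
    change _ = NN σ c y * _
    by_cases hN : NN σ c y = 0
    · simp [hN]
    congr 1
    rw [NN_eq_ker σ c y hN, ← card_erase_of_mem (a := 0) (by simp)]
    congr 1
    ext v; simp
  have h1 : ∑ y : F, NN σ c y * (NN σ c y - 1) = #{p : F × F × F |
      (σ p.1 + c) * σ p.2.1 + p.1 * p.2.1 + 1 = 0 ∧
      (p.2.2 ≠ 0 ∧ (σ p.1 + c) * σ p.2.2 + p.1 * p.2.2 = 0)} := by
    simp_rw [h0, ← card_product, ← filter_product]
    simp only [card_filter, Fintype.sum_prod_type, univ_product_univ]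
  rw [h1]
  have hw0 : ∀ z : F, σ.symm ((σ z + z + 1) / c) ≠ 0 := by
    intro z; rw [Ne, RingEquiv.map_eq_zero_iff]; exact div_ne_zero (hσ z) hc
  refine card_nbij' (fun p => p.2.2 / p.2.1)
    (fun r => let z := σ r / (σ r - r); let w := σ.symm ((σ z + z + 1) / c); (z / w, w, r * w))
    ?_ ?_ ?_ ?_
  · rintro ⟨y, w, v⟩ h
    simp only [coe_filter, mem_univ, true_and, Set.mem_ofPred_eq, map_div₀] at h ⊢
    obtain ⟨ha, hv, hb⟩ := h
    have hw : w ≠ 0 := by rintro rfl; simp at ha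
    have hs : σ w ≠ 0 := by simpa using hw
    have hs' : σ v ≠ 0 := by simpa using hv
    intro h
    rw [div_eq_div_iff hs hw] at h
    apply hs'
    linear_combination σ v * ha - σ w * hb - y * h
  · intro r hr
    simp only [coe_filter, mem_univ, true_and, Set.mem_ofPred_eq] at hr ⊢
    have hr' : σ r - r ≠ 0 := sub_ne_zero.2 hr
    have hr0 : r ≠ 0 := by rintro rfl; simp at hr
    have hz : (σ r / (σ r - r)) * (σ r - r) = σ r := div_mul_cancel₀ _ hr'
    generalize σ r / (σ r - r) = z at *
    have hw := hw0 z
    have hsw : σ (σ.symm ((σ z + z + 1) / c)) * c = σ z + z + 1 := by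
      rw [RingEquiv.apply_symm_apply, div_mul_cancel₀ _ hc]
    generalize σ.symm ((σ z + z + 1) / c) = w at *
    have hs : σ w ≠ 0 := by simpa using hw
    refine ⟨?_, mul_ne_zero hr0 hw, ?_⟩
    · rw [map_div₀]
      field_simp
      linear_combination hsw + (σ z + z + 1) * h2
    · rw [map_div₀, map_mul]
      field_simp
      linear_combination σ r * hsw + (σ z * σ r + r * z) * h2 + hz + σ r * h2
  · rintro ⟨y, w, v⟩ h
    simp only [coe_filter, mem_univ, true_and, Set.mem_ofPred_eq] at h ⊢
    obtain ⟨ha, hv, hb⟩ := h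
    have hw : w ≠ 0 := by rintro rfl; simp at ha
    have hs : σ w ≠ 0 := by simpa using hw
    have hs' : σ v ≠ 0 := by simpa using hv
    have hkey : σ v * (y * w + 1) = y * v * σ w := by
      linear_combination σ v * ha - σ w * hb
    have hne : σ (v / w) - v / w ≠ 0 := by
      intro h
      rw [map_div₀, div_sub_div _ _ hs hw, div_eq_zero_iff] at h
      have h := h.resolve_right (mul_ne_zero hs hw)
      apply hs'
      linear_combination hkey - y * h
    have hz : σ (v / w) / (σ (v / w) - v / w) = y * w := by
      rw [div_eq_iff hne, map_div₀]
      field_simp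
      linear_combination hkey + y * (v * σ w - w * σ v) * h2
    have : σ.symm ((σ (y * w) + y * w + 1) / c) = w := by
      rw [RingEquiv.symm_apply_eq, div_eq_iff hc, map_mul]
      linear_combination ha - c * σ w * h2
    simp only [hz, this]
    simp [hw]
  · intro r _
    exact mul_div_cancel_right₀ _ (hw0 _)

lemma fib_mul (σ : F ≃+* F) (c : F) (h2 : (2 : F) = 0) (k : ℕ) :
    #{y : F | NN σ c y = k} = (k + 1) * #{b : F | nn σ c b = k + 1} := by
  rw [card_eq_sum_card_fiberwise (f := fun y => σ y * y - c * y)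
    (t := ({b : F | nn σ c b = k + 1} : Finset F))]
  · rw [mul_comm, ← smul_eq_mul, ← sum_const]
    refine sum_congr rfl fun b hb => ?_
    simp only [mem_filter, mem_univ, true_and] at hb
    rw [← hb, filter_filter]
    conv_rhs => rw [nn]
    congr 1
    ext y
    simp only [mem_filter, mem_univ, true_and]
    constructor
    · exact fun h => h.2
    · intro h
      refine ⟨?_, h⟩
      rw [← h, nn_eq h2] at hb
      omega
  · intro y hy
    simp only [coe_filter, mem_univ, true_and, Set.mem_ofPred_eq] at hy ⊢
    rw [nn_eq h2, hy]

end Core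

section Main
open Finset Classical

lemma odd_quot (s i : ℕ) (hi : i < s)
    (hl2 : i = 0 ∨ padicValNat 2 s ≤ padicValNat 2 i) : Odd (s / Nat.gcd i s) := by
  have hs : s ≠ 0 := by omega
  rw [← Nat.not_even_iff_odd]
  intro he
  have h1 : 2 ^ padicValNat 2 s ∣ i := by
    rcases hl2 with rfl | h
    · simp
    · exact (pow_dvd_pow 2 h).trans pow_padicValNat_dvd
  have h2 : 2 ^ padicValNat 2 s ∣ Nat.gcd i s := Nat.dvd_gcd h1 pow_padicValNat_dvd
  apply pow_succ_padicValNat_not_dvd (p := 2) hs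
  have h3 := mul_dvd_mul h2 he.two_dvd
  rwa [Nat.mul_div_cancel' (Nat.gcd_dvd_right i s), ← pow_succ] at h3

lemma pow_Qm {F : Type*} [Field F] [Fintype F] (s i : ℕ)
    (hF : Fintype.card F = 2 ^ s) (x : F) : x ^ (2 ^ i) ^ (s / Nat.gcd i s) = x := by
  have : (2 ^ i) ^ (s / Nat.gcd i s) = Fintype.card F ^ (i / Nat.gcd i s) := by
    rw [hF, ← pow_mul, ← pow_mul, ← Nat.mul_div_assoc _ (Nat.gcd_dvd_right i s),
      ← Nat.mul_div_assoc _ (Nat.gcd_dvd_left i s), mul_comm]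
  rw [this, FiniteField.pow_card_pow]

lemma fixed_card {F : Type*} [Field F] [Fintype F] (s i : ℕ)
    (hF : Fintype.card F = 2 ^ s) : #{r : F | r ^ 2 ^ i = r} = 2 ^ Nat.gcd i s := by
  have h1 := IsCyclic.card_powMonoidHom_ker (G := Fˣ) (2 ^ i - 1)
  have hu : Nat.card Fˣ = 2 ^ s - 1 := by
    rw [Nat.card_units, Nat.card_eq_fintype_card, hF]
  rw [hu, Nat.gcd_comm, Nat.pow_sub_one_gcd_pow_sub_one] at h1
  have h0 : (0 : F) ∈ ({r : F | r ^ 2 ^ i = r} : Finset F) := by simp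
  have hpos : 0 < 2 ^ Nat.gcd i s := by positivity
  rw [← card_erase_add_one h0]
  suffices #(({r : F | r ^ 2 ^ i = r} : Finset F).erase 0) = 2 ^ Nat.gcd i s - 1 by omega
  have hQ : 2 ^ i - 1 + 1 = 2 ^ i := Nat.sub_add_cancel Nat.one_le_two_pow
  rw [← h1, Nat.card_eq_fintype_card, ← card_univ]
  symm
  refine card_bij (fun u _ => ((u : Fˣ) : F)) ?_ ?_ ?_
  · rintro ⟨u, hu⟩ _
    rw [MonoidHom.mem_ker, powMonoidHom_apply] at hu
    have hu' : (u : F) ^ (2 ^ i - 1) = 1 := by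
      rw [← Units.val_pow_eq_pow_val, hu, Units.val_one]
    simp only [mem_erase, mem_filter, mem_univ, true_and]
    refine ⟨u.ne_zero, ?_⟩
    rw [← hQ, pow_succ, hu', one_mul]
  · intro a _ b _ h
    exact Subtype.ext (Units.ext h)
  · intro r hr
    simp only [mem_erase, mem_filter, mem_univ, true_and] at hr
    refine ⟨⟨Units.mk0 r hr.1, ?_⟩, mem_univ _, rfl⟩
    rw [MonoidHom.mem_ker, powMonoidHom_apply]
    ext
    simp only [Units.val_pow_eq_pow_val, Units.val_mk0, Units.val_one]
    apply mul_right_cancel₀ hr.1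
    rw [← pow_succ, hQ, hr.2, one_mul]

lemma arith (P R A B Z M0 M1 M2 Mk : ℕ) (hP : 2 ≤ P) (hR : 1 ≤ R)
    (e1 : A + P * B = P * R) (e2 : P * (P - 1) * B = P * R - P)
    (e3 : Z + A + B = P * R) (eA : A = 2 * M2) (eB : B = (P + 1) * Mk) (eZ : Z = M1)
    (e4 : M0 + M1 + M2 + Mk = P * R) :
    M0 = (P * R * P + P) / (2 * (P + 1)) ∧ M1 = R - 1 ∧
    M2 = (P * R * P - P * R * 2 + P) / (2 * (P - 1)) ∧ Mk = (R - 1) / (P * P - 1) := by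
  obtain ⟨p, rfl⟩ : ∃ p, P = p + 2 := ⟨P - 2, by omega⟩
  obtain ⟨r, rfl⟩ : ∃ r, R = r + 1 := ⟨R - 1, by omega⟩
  have hB : (p + 1) * B = r := by
    have : (p + 2) * (r + 1) - (p + 2) = (p + 2) * r := by
      rw [mul_add, mul_one, Nat.add_sub_cancel]
    rw [this, mul_assoc] at e2
    exact Nat.eq_of_mul_eq_mul_left (by omega) e2
  subst eA eZ
  subst hB
  refine ⟨?_, ?_, ?_, ?_⟩
  · symm
    apply Nat.div_eq_of_eq_mul_right (by positivity)
    zify at *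
    linear_combination -2 * ((p : ℤ) + 3) * (e4 - e3) - ((p : ℤ) + 3) * e1 - 2 * eB
  · simp
    zify at *
    linear_combination e3 - e1
  · have : (p + 2) * ((p + 1) * B + 1) * (p + 2) - (p + 2) * ((p + 1) * B + 1) * 2
      = (p + 2) * ((p + 1) * B + 1) * p := by
      rw [mul_add _ p 2, Nat.add_sub_cancel]
    rw [this]
    symm
    apply Nat.div_eq_of_eq_mul_right (by simp)
    have : p + 2 - 1 = p + 1 := rfl
    rw [this]
    zify at *
    linear_combination -((p:ℤ) + 1) * e1
  · have : (p + 2) * (p + 2) - 1 = (p + 1) * (p + 3) := by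
      rw [show (p + 2) * (p + 2) = (p + 1) * (p + 3) + 1 by ring, Nat.add_sub_cancel]
    rw [this]
    symm
    apply Nat.div_eq_of_eq_mul_right (by positivity)
    rw [eB]
    simp
    ring

end Main

theorem stmt19 (s : ℕ) (F : Type*) [Field F] [Fintype F]
    (hF : Fintype.card F = 2 ^ s) (i h : ℕ) (hi : i < s) (hh : h = Nat.gcd i s)
    (hl2 : i = 0 ∨ padicValNat 2 s ≤ padicValNat 2 i) :
    Function.Bijective (fun x : F => x ^ (2 ^ i + 1)) ∧
    (∀ c : F, c ≠ 0 →
      Nat.card {b : F // Nat.card {x : F // x ^ (2 ^ i + 1) - c * x = b} = 0}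
        = (2 ^ (s + h) + 2 ^ h) / (2 * (2 ^ h + 1)) ∧
      Nat.card {b : F // Nat.card {x : F // x ^ (2 ^ i + 1) - c * x = b} = 1}
        = 2 ^ (s - h) - 1 ∧
      Nat.card {b : F // Nat.card {x : F // x ^ (2 ^ i + 1) - c * x = b} = 2}
        = (2 ^ (s + h) - 2 ^ (s + 1) + 2 ^ h) / (2 * (2 ^ h - 1)) ∧
      Nat.card {b : F // Nat.card {x : F // x ^ (2 ^ i + 1) - c * x = b} = 2 ^ h + 1}
        = (2 ^ (s - h) - 1) / (2 ^ (2 * h) - 1)) := by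
  classical
  have hchar : CharP F 2 := charP_of_card_eq_prime_pow hF
  have h2 : (2 : F) = 0 := CharTwo.two_eq_zero
  have hm := odd_quot s i hi hl2
  have hpow := pow_Qm s i hF
  have hfix := fixed_card s i hF
  have hs0 : 0 < s := by omega
  have hh0 : 0 < h := by rw [hh]; exact Nat.gcd_pos_of_pos_right _ hs0
  have hhs : h ≤ s := by rw [hh]; exact Nat.gcd_le_right _ hs0
  rw [← hh] at hfix
  generalize s / Nat.gcd i s = m at hm hpow
  constructor
  · rw [← Finite.injective_iff_bijective]
    intro x y hxy
    simp only at hxy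
    by_cases hy : y = 0
    · subst hy
      simpa using hxy
    have hr : (x / y) ^ (2 ^ i + 1) = 1 := by
      rw [div_pow, hxy, div_self (pow_ne_zero _ hy)]
    have hd : 2 ^ i + 1 ∣ (2 ^ i) ^ m + 1 := by
      simpa using Odd.nat_add_dvd_pow_add_pow (2 ^ i) 1 hm
    obtain ⟨k, hk⟩ := hd
    have h3 : (x / y) ^ ((2 ^ i) ^ m + 1) = 1 := by rw [hk, pow_mul, hr, one_pow]
    rw [pow_succ, hpow] at h3
    have h4 : (x / y) ^ 2 = 1 ^ 2 := by rw [sq, h3, one_pow]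
    exact (div_eq_one_iff_eq hy).1 (CharTwo.sq_inj.1 h4)
  intro c hc
  let σ : F ≃+* F := RingEquiv.ofBijective (iterateFrobenius F 2 i)
    ((Finite.injective_iff_bijective).1 (RingHom.injective _))
  have hσ : ∀ x, σ x = x ^ 2 ^ i := fun x => iterateFrobenius_def 2 i x
  have hne : ∀ z, σ z + z + 1 ≠ 0 := by
    intro z hz
    have hz1 : z ^ 2 ^ i = z + 1 := by
      rw [← hσ]
      linear_combination hz - (z + 1) * h2
    have hk : ∀ k : ℕ, z ^ (2 ^ i) ^ k = z + k := by
      intro k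
      induction k with
      | zero => simp
      | succ k ih =>
        rw [pow_succ, pow_mul, ih, add_pow_char_pow, hz1, ← iterateFrobenius_def 2 i (k : F),
          map_natCast]
        push_cast; ring
    have h3 := hk m
    rw [hpow, CharTwo.natCast_eq_ite, if_neg (Nat.not_even_iff_odd.2 hm)] at h3
    simp at h3
  have hfix' : Finset.card ({r : F | σ r = r} : Finset F) = 2 ^ h := by
    simp only [hσ]
    rw [← hfix]
  have hn : ∀ b, Nat.card {x : F // x ^ (2 ^ i + 1) - c * x = b} = nn σ c b := by
    intro b
    rw [Nat.card_eq_fintype_card, Fintype.card_subtype, nn]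
    simp only [hσ, pow_succ]
  have hcard : ∀ k, Nat.card {b : F // nn σ c b = k} = Finset.card ({b : F | nn σ c b = k} : Finset F) := by
    intro k
    rw [Nat.card_eq_fintype_card, Fintype.card_subtype]
  simp only [hn, hcard]
  have hP2 : 2 ≤ 2 ^ h := by
    calc 2 = 2 ^ 1 := rfl
      _ ≤ 2 ^ h := Nat.pow_le_pow_right (by norm_num) hh0
  have hcases := fun y => NN_cases σ (2 ^ h) (by convert hfix') c y hc
  have hsum := sum_NN h2 σ hne c hc
  have hsum2 := sum_NN2 h2 σ hne c hc
  have hf0 := fib_mul σ c h2 0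
  have hf1 := fib_mul σ c h2 1
  have hfk := fib_mul σ c h2 (2 ^ h)
  have hPR : 2 ^ s = 2 ^ h * 2 ^ (s - h) := by rw [← pow_add]; congr 1; omega
  have hncases : ∀ b, nn σ c b = 0 ∨ nn σ c b = 1 ∨ nn σ c b = 2 ∨ nn σ c b = 2 ^ h + 1 := by
    intro b
    by_cases hb : nn σ c b = 0
    · exact Or.inl hb
    right
    obtain ⟨y, hy⟩ := Finset.card_pos.1 (Nat.pos_of_ne_zero hb)
    simp at hy
    rw [← hy, nn_eq h2]
    have := hcases y
    omega
  rw [pow_add 2 s h, pow_succ 2 s, two_mul h, pow_add 2 h h, hPR]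
  refine arith (2 ^ h) (2 ^ (s - h)) (Finset.card {y : F | NN σ c y = 1})
    (Finset.card {y : F | NN σ c y = 2 ^ h}) (Finset.card {y : F | NN σ c y = 0}) _ _ _ _
    hP2 Nat.one_le_two_pow ?_ ?_ ?_ ?_ ?_ ?_ ?_
  · rw [← hPR, ← hF, ← hsum]
    simp only [Finset.card_filter, Finset.mul_sum, ← Finset.sum_add_distrib]
    refine Finset.sum_congr rfl fun y _ => ?_
    rcases hcases y with h | h | h <;> rw [h] <;> split_ifs <;> omega
  · have h5 : Finset.card ({r : F | σ r ≠ r} : Finset F) = 2 ^ s - 2 ^ h := by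
      have := Finset.card_filter_add_card_filter_not (s := (Finset.univ : Finset F)) (fun r => σ r = r)
      rw [hfix', Finset.card_univ, hF] at this
      simp only [ne_eq]
      omega
    rw [← hPR, ← h5]
    trans ∑ y : F, NN σ c y * (NN σ c y - 1)
    · simp only [Finset.card_filter, Finset.mul_sum]
      refine Finset.sum_congr rfl fun y _ => ?_
      rcases hcases y with h | h | h <;> rw [h]
      · rw [if_neg (by omega)]; simp
      · rw [if_neg (by omega)]; simp
      · simp
    · rw [hsum2]
  · rw [← hPR, ← hF, ← Finset.card_univ, Finset.card_eq_sum_ones Finset.univ]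
    simp only [Finset.card_filter, ← Finset.sum_add_distrib]
    refine Finset.sum_congr rfl fun y _ => ?_
    have := hcases y
    split_ifs <;> omega
  · convert hf1
  · convert hfk
  · simp only [zero_add, one_mul] at hf0
    convert hf0
  · rw [← hPR, ← hF, ← Finset.card_univ, Finset.card_eq_sum_ones Finset.univ]
    simp only [Finset.card_filter, ← Finset.sum_add_distrib]
    refine Finset.sum_congr rfl fun y _ => ?_
    have := hncases y
    split_ifs <;> omega
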